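/- arXiv:2208.10110 — 5 statements merged into one kernel-verified Lean document; each statement's English description precedes it below -/
import Mathlib

section
/- Let n be an even positive integer, let s ≥ 1 with 2s ≤ n, and let δ = s·2^{2s+1}·⌈log₂ n⌉. Call a permutation σ of {1,…,n} (p,δ)-dense if for every i with 1 ≤ i ≤ n−δ+1 there exists j with i ≤ j ≤ i+δ−2s such that σ_j, σ_{j+1}, …, σ_{j+s−1} are all even and σ_{j+s}, …, σ_{j+2s−1} are all odd. Then the number of (p,δ)-dense permutations of {1,…,n} is at least n!/2. -/
namespace Stmt

def sig {α : Type*} [LinearOrder α] (u : ℕ → α) : ℕ → ℕ :=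
  fun i => if u i ≤ u (i+1) then 1 else 0

def row1 {α : Type*} (s : ℕ) (u : ℕ → α) : ℕ → α :=
  fun i => u ((i-1)*s + 1)

def betaProj {α : Type*} [LinearOrder α] (u : ℕ → α) (m i : ℕ) : ℕ :=
  ((Finset.Icc 1 m).filter (fun j => u j < u i)).card
  + ((Finset.Icc 1 i).filter (fun j => u j = u i)).card

def blockAt {α : Type*} (u : ℕ → α) (L t k : ℕ) : ℕ → α :=
  fun j => u (((k-1) % t) * L + j)

def pairBlk {α : Type*} (u : ℕ → α) (L t k : ℕ) : ℕ → α :=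
  fun j => if j ≤ L then blockAt u L t k j else blockAt u L t (k+1) (j - L)

def rowSumBeta {α : Type*} [LinearOrder α] (s P : ℕ) (v : ℕ → α) : ℕ :=
  ∑ i ∈ Finset.range (2*P), betaProj v (2*P*s) (i*s+1)

def CRetrieve {α : Type*} [LinearOrder α] (n s P c1 c2 : ℕ) (u : ℕ → α) : Prop :=
  (∑ i ∈ Finset.Icc 1 (n/(2*P*s)),
      rowSumBeta s P (pairBlk u (P*s) (n/(P*s)) (2*i-1))) ≡ c1 [MOD 2*P*s]
  ∧ (∑ i ∈ Finset.Icc 1 (n/(2*P*s)),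
      rowSumBeta s P (pairBlk u (P*s) (n/(P*s)) (2*i))) ≡ c2 [MOD 2*P*s]

def permRank {α : Type*} [LinearOrder α] (u : ℕ → α) (m : ℕ) : ℕ :=
  1 + (((List.range' 1 m).permutations).filter
    (fun l => decide (List.Lex (· < ·) l
      ((List.range' 1 m).map (fun i => betaProj u m i))))).length

def CRecover {α : Type*} [LinearOrder α] (n h d1 d2 : ℕ) (u : ℕ → α) : Prop :=
  (∑ i ∈ Finset.Icc 1 (n/(2*h)), permRank (pairBlk u h (n/h) (2*i-1)) (2*h))
      ≡ d1 [MOD Nat.factorial (2*h)]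
  ∧ (∑ i ∈ Finset.Icc 1 (n/(2*h)), permRank (pairBlk u h (n/h) (2*i)) (2*h))
      ≡ d2 [MOD Nat.factorial (2*h)]

def BurstDelEq {α : Type*} (n s : ℕ) (x y : ℕ → α) (i i' : ℕ) : Prop :=
  ∀ j ∈ Finset.Icc 1 (n - s),
    (if j < i then x j else x (j + s)) = (if j < i' then y j else y (j + s))

def NoRun (m P : ℕ) (y : ℕ → ℕ) : Prop :=
  ∀ i, 1 ≤ i → i + P - 1 ≤ m → ∃ j, i ≤ j ∧ j + 1 ≤ i + P - 1 ∧ y j ≠ y (j+1)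

def seqOf (n : ℕ) (π : Equiv.Perm (Fin n)) : ℕ → ℕ :=
  fun i => if h : i - 1 < n then (π ⟨i-1, h⟩ : ℕ) + 1 else 0

def insSeq (π : ℕ → ℕ) (j v : ℕ) : ℕ → ℕ :=
  fun i => if i ≤ j then π i else if i = j+1 then v else π (i-1)


/-- Occurrence of the pattern at position `j` in the indicator set `T`. -/
def occ (s : ℕ) (T : Finset ℕ) (j : ℕ) : Prop :=
  ∀ l, l < s → j + l ∉ T ∧ j + s + l ∈ T

/-- No occurrence inside the window `[i, i+m)`. -/
def avoid (s : ℕ) (T : Finset ℕ) (i m : ℕ) : Prop :=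
  ∀ j, i ≤ j → j + 2*s ≤ i + m → ¬ occ s T j

open Classical in
noncomputable def avSet (n s i m : ℕ) : Finset (Finset ℕ) :=
  (Finset.range n).powerset.filter (fun T => avoid s T i m)

lemma occ_overlap {s : ℕ} {T : Finset ℕ} {j j' : ℕ} (h : occ s T j) (h' : occ s T j')
    (h1 : j < j') (h2 : j' < j + 2*s) : False := by
  by_cases hd : j' ≤ j + s
  · have a := (h 0 (by omega)).2
    have b := (h' (j + s - j') (by omega)).1
    apply b
    convert a using 1
    omega
  · have a := (h' 0 (by omega)).1
    have b := (h (j' - j - s) (by omega)).2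
    apply a
    convert b using 1
    omega

lemma avoid_mono {s : ℕ} {T : Finset ℕ} {i m m' : ℕ} (h : avoid s T i m) (hm : m' ≤ m) :
    avoid s T i m' := fun j h1 h2 => h j h1 (by omega)

open Classical in
lemma step (n s i m : ℕ) (hs : 1 ≤ s) (hm : 2*s ≤ m+1) (hn : i + m + 1 ≤ n) :
    4^s * (avSet n s i (m+1)).card + (avSet n s i m).card ≤ 4^s * (avSet n s i m).card := by
  obtain ⟨k, hk⟩ : ∃ k, m + 1 = k + 2*s := ⟨m+1-2*s, by omega⟩
  set B : Finset (Finset ℕ) :=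
    (Finset.range n).powerset.filter (fun T => avoid s T i k ∧ occ s T (i+k)) with hB
  have h1 : (avSet n s i (m+1)).card + B.card ≤ (avSet n s i m).card := by
    rw [← Finset.card_union_of_disjoint]
    · apply Finset.card_le_card
      intro T hT
      simp only [hB, avSet, Finset.mem_union, Finset.mem_filter] at hT ⊢
      rcases hT with ⟨h, h'⟩ | ⟨h, h', h''⟩
      · exact ⟨h, avoid_mono h' (by omega)⟩
      · refine ⟨h, fun j hj1 hj2 ho => ?_⟩
        by_cases hj : j + 2*s ≤ i + k
        · exact h' j hj1 hj ho
        · exact occ_overlap ho h'' (by omega) (by omega)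
    · rw [Finset.disjoint_left]
      intro T hT hT'
      simp only [hB, avSet, Finset.mem_filter] at hT hT'
      exact hT.2 (i+k) (by omega) (by omega) hT'.2.2
  have h2 : (avSet n s i m).card ≤ B.card * 4^s := by
    have hc : (Finset.Ico (i+k) (i+k+2*s)).powerset.card = 4^s := by
      rw [Finset.card_powerset, Nat.card_Ico, Nat.add_sub_cancel_left, pow_mul]; norm_num
    rw [← hc, ← Finset.card_product]
    apply Finset.card_le_card_of_injOn
      (fun T => ((T \ Finset.Ico (i+k) (i+k+2*s)) ∪ Finset.Ico (i+k+s) (i+k+2*s),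
        T ∩ Finset.Ico (i+k) (i+k+2*s)))
    · intro T hT
      simp only [avSet, Finset.coe_filter, Set.mem_ofPred_eq, Finset.mem_powerset] at hT
      obtain ⟨hT1, hT2⟩ := hT
      simp only [Finset.coe_product, Set.mem_prod, Finset.mem_coe, hB, Finset.mem_filter,
        Finset.mem_powerset]
      refine ⟨⟨?_, ?_, ?_⟩, Finset.inter_subset_right⟩
      · intro x hx
        simp only [Finset.mem_union, Finset.mem_sdiff, Finset.mem_Ico, Finset.mem_range] at hx ⊢
        rcases hx with hx | hx
        · exact Finset.mem_range.1 (hT1 hx.1)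
        · omega
      · intro j hj1 hj2 ho
        apply hT2 j hj1 (by omega)
        intro l hl
        have := ho l hl
        simp only [Finset.mem_union, Finset.mem_sdiff, Finset.mem_Ico] at this
        refine ⟨fun h => this.1 (Or.inl ⟨h, by omega⟩), ?_⟩
        rcases this.2 with h | h
        · exact h.1
        · omega
      · intro l hl
        simp only [Finset.mem_union, Finset.mem_sdiff, Finset.mem_Ico]
        constructor
        · rintro (h | h) <;> omega
        · right; omega
    · intro T hT T' hT' h
      simp only [Prod.mk.injEq] at h
      obtain ⟨ha, hb⟩ := h
      ext x
      have e1 := Finset.ext_iff.1 ha x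
      have e2 := Finset.ext_iff.1 hb x
      simp only [Finset.mem_union, Finset.mem_sdiff, Finset.mem_inter, Finset.mem_Ico] at e1 e2
      by_cases hx : i + k ≤ x ∧ x < i + k + 2*s
      · simpa [hx] using e2
      · have hx' : ¬ (i + k + s ≤ x ∧ x < i + k + 2*s) := by omega
        simpa [hx, hx'] using e1
  nlinarith [Nat.mul_le_mul_left (4^s) h1]

lemma iter (n s i t : ℕ) (hs : 1 ≤ s) (hn : i + (2*s - 1 + t) ≤ n) :
    ((avSet n s i (2*s-1+t)).card : ℝ) ≤ 2^n * (1 - 1/4^s)^t := by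
  induction t with
  | zero =>
    have : (avSet n s i (2*s-1+0)).card ≤ 2^n := by
      classical
      refine (Finset.card_le_card (Finset.filter_subset _ _)).trans ?_
      simp
    simpa using (by exact_mod_cast this : ((avSet n s i (2*s-1+0)).card : ℝ) ≤ 2^n)
  | succ t ih =>
    have ih := ih (by omega)
    have h := step n s i (2*s-1+t) hs (by omega) (by omega)
    have h' : (4:ℝ)^s * (avSet n s i (2*s-1+(t+1))).card + (avSet n s i (2*s-1+t)).card
      ≤ 4^s * (avSet n s i (2*s-1+t)).card := by exact_mod_cast h
    have hp : (0:ℝ) < 4^s := by positivity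
    have h1 : (1:ℝ) ≤ 4^s := one_le_pow₀ (by norm_num)
    have h3 : (0:ℝ) ≤ 1 - 1/4^s := by
      rw [sub_nonneg, div_le_one hp]; exact h1
    calc ((avSet n s i (2*s-1+(t+1))).card : ℝ)
        ≤ (avSet n s i (2*s-1+t)).card * (1 - 1/4^s) := by
          rw [← mul_le_mul_iff_right₀ hp]
          have : (4:ℝ)^s * ((avSet n s i (2*s-1+t)).card * (1 - 1/4^s))
            = 4^s * (avSet n s i (2*s-1+t)).card - (avSet n s i (2*s-1+t)).card := by
            field_simp
          linarith
      _ ≤ (2^n * (1 - 1/4^s)^t) * (1 - 1/4^s) := by gcongr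
      _ = _ := by ring

lemma qbound (s t L : ℕ) (hs : 1 ≤ s) (hL : 2 ≤ L) (ht : t + 2*s = s * 2^(2*s+1) * L + 1) :
    (4:ℝ)^L * (1 - 1/4^s)^t ≤ 1 := by
  have hp : (0:ℝ) < 4^s := by positivity
  have h1 : (1:ℝ) ≤ 4^s := one_le_pow₀ (by norm_num)
  have h3 : (0:ℝ) ≤ 1 - 1/4^s := by
    rw [sub_nonneg, div_le_one hp]; exact h1
  have h4 : (1:ℝ) - 1/4^s ≤ 1 := by
    have : (0:ℝ) ≤ 1/4^s := by positivity
    linarith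
  obtain ⟨r, rfl⟩ : ∃ r, L = r + 2 := ⟨L - 2, by omega⟩
  have hs4 : 2*s ≤ 4^s := by
    clear ht h4 h3 h1 hp
    induction s, hs using Nat.le_induction with
    | base => norm_num
    | succ k hk ih => rw [pow_succ]; omega
  have ht' : 4^s * (2*r+3) ≤ t := by
    have e : 2^(2*s+1) = 2 * 4^s := by rw [pow_succ, pow_mul]; norm_num; ring
    rw [e] at ht
    obtain ⟨u, rfl⟩ : ∃ u, s = u + 1 := ⟨s - 1, by omega⟩
    generalize 4^(u+1) = N at *
    have : (u+1) * (2*N) * (r+2) = N*(2*r+3) + N + 2*u*N*(r+2) := by ring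
    have := Nat.zero_le (2*u*N*(r+2))
    omega
  have hq : (1 - 1/(4:ℝ)^s)^(4^s) ≤ 3/8 := by
    have a : (1:ℝ) - 1/4^s ≤ Real.exp (-(1/4^s)) := by
      have := Real.add_one_le_exp (-(1/(4:ℝ)^s)); linarith
    calc (1 - 1/(4:ℝ)^s)^(4^s) ≤ (Real.exp (-(1/4^s)))^(4^s) := by gcongr
      _ = Real.exp (-1) := by
        rw [← Real.exp_nat_mul]; congr 1; push_cast; field_simp
      _ ≤ 3/8 := by have := Real.exp_neg_one_lt_d9; linarith
  calc (4:ℝ)^(r+2) * (1 - 1/4^s)^t ≤ 4^(r+2) * (1 - 1/4^s)^(4^s * (2*r+3)) := by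
        gcongr ?_ * ?_
        exact pow_le_pow_of_le_one h3 h4 ht'
    _ ≤ 4^(r+2) * (3/8)^(2*r+3) := by rw [pow_mul]; gcongr
    _ = (9/16)^r * (4^2 * (3/8)^3) := by
        rw [pow_add, pow_add, pow_mul, show (9/16:ℝ) = 4 * (3/8)^2 by norm_num, mul_pow]; ring
    _ ≤ 1 * 1 := by
        gcongr
        · exact pow_le_one₀ (by norm_num) (by norm_num)
        · norm_num
    _ = 1 := by norm_num

def par (n : ℕ) : Fin n → Bool := fun x => decide (Odd ((x:ℕ) + 1))

noncomputable def pset (n : ℕ) (π : Equiv.Perm (Fin n)) : Finset ℕ :=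
  (Finset.range n).filter (fun k => Odd (seqOf n π (k+1)))

lemma card_par (m : ℕ) (b : Bool) : Fintype.card {a : Fin (2*m) // par (2*m) a = b} = m := by
  rw [Fintype.card_subtype, Finset.card_filter]
  change (∑ i : Fin (2*m), if decide (Odd ((i:ℕ)+1)) = b then 1 else 0) = m
  rw [Fin.sum_univ_eq_sum_range (fun x => if decide (Odd (x+1)) = b then 1 else 0)]
  induction m with
  | zero => simp
  | succ k ih =>
    rw [show 2*(k+1) = 2*k+1+1 by ring, Finset.sum_range_succ, Finset.sum_range_succ, ih]
    have h1 : Odd (2*k+1) := ⟨k, rfl⟩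
    have h2 : ¬ Odd (2*k+1+1) := by rw [Nat.not_odd_iff_even]; exact ⟨k+1, by ring⟩
    cases b <;> simp [h1, h2]

open Classical in
lemma fiber (m : ℕ) (T : Finset ℕ) :
    ((Finset.univ : Finset (Equiv.Perm (Fin (2*m)))).filter (fun π => pset (2*m) π = T)).card
      ≤ m.factorial * m.factorial := by
  rcases Finset.eq_empty_or_nonempty
    ((Finset.univ : Finset (Equiv.Perm (Fin (2*m)))).filter (fun π => pset (2*m) π = T)) with h | h
  · rw [h]; simp
  obtain ⟨π₀, h₀⟩ := h
  rw [Finset.mem_filter] at h₀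
  have hc : Fintype.card {g : Equiv.Perm (Fin (2*m)) // par (2*m) ∘ g = par (2*m)}
      = m.factorial * m.factorial := by
    rw [DomMulAct.stabilizer_card]
    simp [card_par, sq]
  rw [← hc, Fintype.card_subtype]
  apply Finset.card_le_card_of_injOn (fun π => π * π₀⁻¹)
  · intro π hπ
    simp only [Finset.coe_filter, Set.mem_ofPred_eq, Finset.mem_univ, true_and] at hπ ⊢
    have key : ∀ x, par (2*m) (π x) = par (2*m) (π₀ x) := by
      intro x
      have := Finset.ext_iff.1 (hπ.trans h₀.2.symm) (x:ℕ)
      simpa [pset, seqOf, par] using this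
    funext x
    simpa using key (π₀⁻¹ x)
  · intro a _ b _ hab
    simpa using hab

lemma dense_of_avoid (n s δ : ℕ) (π : Equiv.Perm (Fin n))
    (h : ∀ i, i + δ ≤ n → ¬ avoid s (pset n π) i δ) :
    ∀ i, 1 ≤ i → i + δ - 1 ≤ n →
        ∃ j, i ≤ j ∧ j + 2*s ≤ i + δ ∧
          ∀ l, l < s → Even (seqOf n π (j+l)) ∧ Odd (seqOf n π (j+s+l)) := by
  intro i hi hid
  have h1 := h (i-1) (by omega)
  unfold avoid at h1
  push Not at h1
  obtain ⟨j, hj1, hj2, ho⟩ := h1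
  refine ⟨j+1, by omega, by omega, fun l hl => ?_⟩
  have := ho l hl
  simp only [pset, Finset.mem_filter, Finset.mem_range, not_and, Nat.not_odd_iff_even] at this
  rw [show j + 1 + l = j + l + 1 by ring, show j + 1 + s + l = j + s + l + 1 by ring]
  exact ⟨this.1 (by omega), this.2.2⟩

open Classical in
lemma bad_bound (m s δ : ℕ) :
    ((Finset.univ : Finset (Equiv.Perm (Fin (2*m)))).filter
      (fun π => ∃ i, i + δ ≤ 2*m ∧ i < 2*m ∧ avoid s (pset (2*m) π) i δ)).card
    ≤ ∑ i ∈ (Finset.range (2*m)).filter (fun i => i + δ ≤ 2*m),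
        m.factorial * m.factorial * (avSet (2*m) s i δ).card := by
  have hsub : ((Finset.univ : Finset (Equiv.Perm (Fin (2*m)))).filter
      (fun π => ∃ i, i + δ ≤ 2*m ∧ i < 2*m ∧ avoid s (pset (2*m) π) i δ)) ⊆
      ((Finset.range (2*m)).filter (fun i => i + δ ≤ 2*m)).biUnion
        (fun i => Finset.univ.filter (fun π => avoid s (pset (2*m) π) i δ)) := by
    intro π hπ
    simp only [Finset.mem_filter, Finset.mem_univ, true_and, Finset.mem_biUnion,
      Finset.mem_range] at hπ ⊢
    obtain ⟨i, h1, h2, h3⟩ := hπ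
    exact ⟨i, ⟨h2, h1⟩, h3⟩
  refine (Finset.card_le_card hsub).trans (Finset.card_biUnion_le.trans ?_)
  apply Finset.sum_le_sum
  intro i _
  apply Finset.card_le_mul_card_image_of_maps_to (f := pset (2*m))
  · intro π hπ
    simp only [Finset.mem_filter, Finset.mem_univ, true_and] at hπ
    simp only [avSet, Finset.mem_filter, Finset.mem_powerset]
    exact ⟨Finset.filter_subset _ _, hπ⟩
  · intro T _
    refine le_trans (Finset.card_le_card ?_) (fiber m T)
    exact Finset.filter_subset_filter _ (Finset.filter_subset _ _)

open Classical in
lemma bad_half (m s δ : ℕ) (hm : 1 ≤ m) (hs : 1 ≤ s)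
    (hδ : δ = s * 2^(2*s+1) * Nat.clog 2 (2*m)) :
    2 * ((Finset.univ : Finset (Equiv.Perm (Fin (2*m)))).filter
      (fun π => ∃ i, i + δ ≤ 2*m ∧ i < 2*m ∧ avoid s (pset (2*m) π) i δ)).card
    ≤ (2*m).factorial := by
  by_cases hbig : 2*m < δ
  · rw [Finset.filter_false_of_mem]
    · simp
    · rintro π _ ⟨i, h, _⟩
      omega
  have hL1 : 1 ≤ Nat.clog 2 (2*m) := Nat.clog_pos (by norm_num) (by omega)
  have hle : 2*m ≤ 2^(Nat.clog 2 (2*m)) := Nat.le_pow_clog (by norm_num) _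
  set L := Nat.clog 2 (2*m) with hL
  have h8 : 8 ≤ 2^(2*s+1) := by
    calc 8 = 2^3 := by norm_num
      _ ≤ _ := Nat.pow_le_pow_right (by norm_num) (by omega)
  have hδs : 8 * s ≤ δ := by
    rw [hδ]; nlinarith [Nat.mul_le_mul (Nat.mul_le_mul_left s h8) hL1]
  have hL2 : 2 ≤ L := by
    by_contra hlt
    have : L = 1 := by omega
    rw [this] at hle
    omega
  obtain ⟨t, ht⟩ : ∃ t, δ = 2*s - 1 + t := ⟨δ - (2*s-1), by omega⟩
  have hq := qbound s t L hs hL2 (by omega)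
  have h0 : (0:ℝ) ≤ (1 - 1/4^s)^t := by
    apply pow_nonneg
    rw [sub_nonneg, div_le_one (by positivity)]
    exact one_le_pow₀ (by norm_num)
  have hb := bad_bound m s δ
  have hcb := (Nat.four_pow_lt_mul_centralBinom m (by omega)).le
  have hf : (2*m).factorial = m.factorial * m.factorial * m.centralBinom := by
    have := Nat.choose_mul_factorial_mul_factorial (show m ≤ 2*m by omega)
    rw [Nat.centralBinom, ← this, show 2*m - m = m by omega]; ring
  have hb' : ((((Finset.univ : Finset (Equiv.Perm (Fin (2*m)))).filter
      (fun π => ∃ i, i + δ ≤ 2*m ∧ i < 2*m ∧ avoid s (pset (2*m) π) i δ)).card : ℕ) : ℝ)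
      ≤ (2*m) * (m.factorial * m.factorial * (2^(2*m) * (1 - 1/4^s)^t)) := by
    refine (Nat.cast_le.2 hb).trans ?_
    push_cast
    calc _ ≤ ∑ i ∈ (Finset.range (2*m)).filter (fun i => i + δ ≤ 2*m),
        ((m.factorial:ℝ) * m.factorial * (2^(2*m) * (1 - 1/4^s)^t)) := by
          apply Finset.sum_le_sum
          intro i hi
          simp only [Finset.mem_filter] at hi
          gcongr
          rw [ht]
          exact iter (2*m) s i t hs (by omega)
      _ ≤ _ := by
          rw [Finset.sum_const, nsmul_eq_mul]
          gcongr
          have := Finset.card_filter_le (Finset.range (2*m)) (fun i => i + δ ≤ 2*m)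
          rw [Finset.card_range] at this
          exact_mod_cast this
  have hq' : (2*(m:ℝ))^2 * (1 - 1/4^s)^t ≤ 1 := by
    refine le_trans ?_ hq
    gcongr
    have : (2*(m:ℝ)) ≤ 2^L := by exact_mod_cast hle
    calc (2*(m:ℝ))^2 ≤ (2^L)^2 := by gcongr
      _ = 4^L := by rw [← pow_mul, mul_comm, pow_mul]; norm_num
  have hcb' : (2:ℝ)^(2*m) ≤ m * m.centralBinom := by
    rw [pow_mul]; norm_num; exact_mod_cast hcb
  rw [← Nat.cast_le (α := ℝ), hf]
  push_cast
  set F : ℝ := (m.factorial:ℝ) * m.factorial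
  set q : ℝ := (1 - 1/4^s)^t
  have hF : 0 ≤ F := by positivity
  calc _ ≤ 2 * ((2*m) * (F * (2^(2*m) * q))) := by gcongr
    _ ≤ 2 * ((2*m) * (F * ((m * m.centralBinom) * q))) := by gcongr
    _ = F * m.centralBinom * ((2*m)^2 * q) := by ring
    _ ≤ F * m.centralBinom * 1 := by gcongr
    _ = _ := by ring

theorem stmt11 (n s : ℕ) (hn : Even n) (hn1 : 1 ≤ n) (hs : 1 ≤ s) (h2s : 2*s ≤ n)
    (δ : ℕ) (hδ : δ = s * 2^(2*s+1) * Nat.clog 2 n) :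
    Nat.factorial n ≤ 2 * Nat.card {π : Equiv.Perm (Fin n) //
      ∀ i, 1 ≤ i → i + δ - 1 ≤ n →
        ∃ j, i ≤ j ∧ j + 2*s ≤ i + δ ∧
          ∀ l, l < s → Even (seqOf n π (j+l)) ∧ Odd (seqOf n π (j+s+l))} := by
  classical
  obtain ⟨m, hm⟩ := hn
  obtain rfl : n = 2*m := by omega
  have hh := bad_half m s δ (by omega) hs hδ
  have hδ1 : 1 ≤ δ := by
    rw [hδ]
    have : 1 ≤ Nat.clog 2 (2*m) := Nat.clog_pos (by norm_num) (by omega)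
    exact Nat.mul_pos (Nat.mul_pos hs (by positivity)) this
  have hc := Finset.card_filter_add_card_filter_not (s := (Finset.univ : Finset (Equiv.Perm (Fin (2*m)))))
    (fun π => ∃ i, i + δ ≤ 2*m ∧ i < 2*m ∧ avoid s (pset (2*m) π) i δ)
  rw [Finset.card_univ, Fintype.card_perm, Fintype.card_fin] at hc
  rw [Nat.card_eq_fintype_card, Fintype.card_subtype]
  have hg := Finset.card_le_card (Finset.monotone_filter_right
    (Finset.univ : Finset (Equiv.Perm (Fin (2*m))))
    (p := fun π => ¬ ∃ i, i + δ ≤ 2*m ∧ i < 2*m ∧ avoid s (pset (2*m) π) i δ)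
    (q := fun π => ∀ i, 1 ≤ i → i + δ - 1 ≤ 2*m →
        ∃ j, i ≤ j ∧ j + 2*s ≤ i + δ ∧
          ∀ l, l < s → Even (seqOf (2*m) π (j+l)) ∧ Odd (seqOf (2*m) π (j+s+l)))
    (fun π _ hπ => dense_of_avoid (2*m) s δ π
      (fun i hi ha => hπ ⟨i, hi, by omega, ha⟩)))
  omega

end Stmt
end

section
/- Let s ≥ 1, n = st, P ≥ 2, and assume 2Ps divides n. Let b1 ∈ {0,…,P−1}, b2 ∈ {0,1}, c1,c2 ∈ {0,…,2Ps−1}. Let σ and τ be permutations of {1,…,n} such that: σ, τ ∈ C^retrieve_{c1,c2}(n,s,P), and α(σ_{(s,1)}), α(τ_{(s,1)}) ∈ SVT_{b1,b2}(t−1, P). Suppose the burst stable deletion of length s at [i,i+s−1] applied to σ produces the same sequence as the burst stable deletion of length s at [i′,i′+s−1] applied to τ. Let k (resp. k′) be the unique element of [i,i+s−1] (resp. [i′,i′+s−1]) congruent to 1 modulo s, and let j = (k−1)/s + 1, j′ = (k′−1)/s + 1. If |j − j′| ≤ P−1, then σ_{(s,1)} = τ_{(s,1)} and j = j′. -/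
namespace Stmt

theorem arith_core (P j j' X e0 e1 e2 f0 f1 f2 : ℤ) (hjj : j < j') (hP : j' - j ≤ P - 1)
    (he0 : e0 = 0 ∨ e0 = 1) (he1 : e1 = 0 ∨ e1 = 1) (he2 : e2 = 0 ∨ e2 = 1)
    (hf0 : f0 = 0 ∨ f0 = 1) (hf1 : f1 = 0 ∨ f1 = 1) (hf2 : f2 = 0 ∨ f2 = 1)
    (hX0 : 0 ≤ X) (hX1 : X ≤ j' - j - 1)
    (c1 : e1 = 1 → e0 ≤ f0) (c2 : e1 = 0 → f0 ≤ e0)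
    (c3 : f1 = 1 → f2 ≤ e2) (c4 : f1 = 0 → e2 ≤ f2)
    (c5 : e1 = 1 → f1 = 1 → X ≤ j' - j - 2) (c6 : e1 = 0 → f1 = 0 → 1 ≤ X)
    (hW : (2:ℤ) ∣ (e0 + e1 + e2) - (f0 + f1 + f2))
    (hS : P ∣ (j-1)*(e0-f0) + j*e1 - (j'-1)*f1 + X + j'*(e2-f2)) : False := by
  have key : ∀ z : ℤ, P ∣ z → -P < z → z < P → z = 0 := by
    intro z hz h1 h2
    exact Int.eq_zero_of_abs_lt_dvd hz (abs_lt.mpr ⟨h1, h2⟩)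
  have := key _ hS
  rcases he0 with rfl | rfl <;> rcases he1 with rfl | rfl <;> rcases he2 with rfl | rfl <;>
  rcases hf0 with rfl | rfl <;> rcases hf1 with rfl | rfl <;> rcases hf2 with rfl | rfl <;>
  norm_num at * <;> omega

theorem sum_move (a b j j' : ℕ) (f g : ℕ → ℕ) (haj : a ≤ j) (hjj : j ≤ j') (hb : j' < b)
    (h1 : ∀ l, a ≤ l → l < j → f l = g l) (h2 : ∀ l, j ≤ l → l < j' → f (l+1) = g l)
    (h3 : ∀ l, j' < l → l < b → f l = g l) :
    ∑ l ∈ Finset.Ico a b, f l + g j' = ∑ l ∈ Finset.Ico a b, g l + f j := by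
  have s1 : ∀ F : ℕ → ℕ, ∑ l ∈ Finset.Ico a b, F l = ∑ l ∈ Finset.Ico a j, F l
      + ∑ l ∈ Finset.Ico j (j'+1), F l + ∑ l ∈ Finset.Ico (j'+1) b, F l := by
    intro F
    rw [Finset.sum_Ico_consecutive _ haj (by omega), Finset.sum_Ico_consecutive _ (by omega) (by omega)]
  rw [s1 f, s1 g]
  have e1 : ∑ l ∈ Finset.Ico a j, f l = ∑ l ∈ Finset.Ico a j, g l :=
    Finset.sum_congr rfl fun l hl => by
      rw [Finset.mem_Ico] at hl; exact h1 l hl.1 hl.2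
  have e3 : ∑ l ∈ Finset.Ico (j'+1) b, f l = ∑ l ∈ Finset.Ico (j'+1) b, g l :=
    Finset.sum_congr rfl fun l hl => by
      rw [Finset.mem_Ico] at hl; exact h3 l (by omega) hl.2
  have e2 : ∑ l ∈ Finset.Ico j (j'+1), f l = f j + ∑ l ∈ Finset.Ico j j', g l := by
    rw [Finset.sum_eq_sum_Ico_succ_bot (by omega), ← Finset.sum_Ico_add' f j j' 1]
    congr 1
    exact Finset.sum_congr rfl fun l hl => by
      rw [Finset.mem_Ico] at hl; exact h2 l hl.1 hl.2
  rw [e1, e2, e3, Finset.sum_Ico_succ_top hjj g]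
  ring

/-- signature extended by zero -/
def esig (t : ℕ) (u : ℕ → ℕ) (l : ℕ) : ℤ := if 1 ≤ l ∧ l < t then (sig u l : ℤ) else 0

theorem esig01 (t : ℕ) (u : ℕ → ℕ) (l : ℕ) : esig t u l = 0 ∨ esig t u l = 1 := by
  unfold esig sig; split_ifs <;> simp

theorem esig_sum (t : ℕ) (u : ℕ → ℕ) (w : ℕ → ℤ) :
    ∑ l ∈ Finset.Icc 1 (t-1), w l * (sig u l : ℤ) = ∑ l ∈ Finset.range (t+1), w l * esig t u l := by
  have : Finset.Icc 1 (t-1) ⊆ Finset.range (t+1) := by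
    intro x hx; simp at hx ⊢; omega
  rw [← Finset.sum_subset this]
  · refine Finset.sum_congr rfl fun l hl => ?_
    simp at hl
    rw [esig, if_pos (by omega)]
  · intro x _ hx
    simp at hx
    rw [esig, if_neg (by omega)]; simp

theorem split_sum (t j j' : ℕ) (hj : 1 ≤ j) (hjj : j < j') (hj't : j' ≤ t) (F : ℕ → ℤ) :
    ∑ l ∈ Finset.range (t+1), F l = ∑ l ∈ Finset.Ico 0 (j-1), F l + F (j-1)
      + ∑ l ∈ Finset.Ico j j', F l + F j' + ∑ l ∈ Finset.Ico (j'+1) (t+1), F l := by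
  rw [← Finset.sum_Ico_succ_top (by omega : 0 ≤ j-1), Nat.sub_add_cancel hj,
    Finset.sum_Ico_consecutive _ (by omega) (by omega),
    ← Finset.sum_Ico_succ_top (by omega : 0 ≤ j'), Finset.sum_Ico_consecutive _ (by omega) (by omega),
    Finset.range_eq_Ico]

theorem svt_core (t P j j' : ℕ) (u v : ℕ → ℕ) (hj : 1 ≤ j) (hjj : j < j') (hj't : j' ≤ t)
    (hP : j' - j ≤ P - 1) (hP2 : 2 ≤ P)
    (h1 : ∀ l, 1 ≤ l → l < j → u l = v l) (h2 : ∀ l, j ≤ l → l < j' → u (l+1) = v l)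
    (h3 : ∀ l, j' < l → l ≤ t → u l = v l) (ha : u j = v j') (hne : v j ≠ v j')
    (hS : (∑ i ∈ Finset.Icc 1 (t-1), i * sig u i) ≡ (∑ i ∈ Finset.Icc 1 (t-1), i * sig v i) [MOD P])
    (hW : (∑ i ∈ Finset.Icc 1 (t-1), sig u i) ≡ (∑ i ∈ Finset.Icc 1 (t-1), sig v i) [MOD 2]) :
    False := by
  have hS' := (Nat.modEq_iff_dvd.mp hS.symm)
  have hW' := (Nat.modEq_iff_dvd.mp hW.symm)
  push_cast at hS' hW'
  have o : ∀ u : ℕ → ℕ, ∑ l ∈ Finset.Icc 1 (t-1), (sig u l : ℤ)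
      = ∑ l ∈ Finset.range (t+1), 1 * esig t u l := by
    intro u; rw [← esig_sum]; simp
  rw [o, o] at hW'
  rw [esig_sum t u (fun l => (l:ℤ)), esig_sum t v (fun l => (l:ℤ))] at hS'
  set y := esig t u with hy
  set y' := esig t v with hy'
  have gen : ∀ w : ℕ → ℤ, ∑ l ∈ Finset.range (t+1), w l * y l - ∑ l ∈ Finset.range (t+1), w l * y' l
      = w (j-1) * (y (j-1) - y' (j-1)) + w j * y j - w (j'-1) * y' (j'-1) + w j' * (y j' - y' j')
       + ∑ l ∈ Finset.Ico j (j'-1), (w (l+1) - w l) * y' l := by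
    intro w
    rw [split_sum t j j' hj hjj hj't, split_sum t j j' hj hjj hj't]
    have e1 : ∑ l ∈ Finset.Ico 0 (j-1), w l * y l = ∑ l ∈ Finset.Ico 0 (j-1), w l * y' l := by
      refine Finset.sum_congr rfl fun l hl => ?_
      rw [Finset.mem_Ico] at hl
      congr 1
      simp only [hy, hy', esig]
      split_ifs with h
      · unfold sig; rw [h1 l (by omega) (by omega), h1 (l+1) (by omega) (by omega)]
      · rfl
    have e2 : ∑ l ∈ Finset.Ico (j'+1) (t+1), w l * y l = ∑ l ∈ Finset.Ico (j'+1) (t+1), w l * y' l := by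
      refine Finset.sum_congr rfl fun l hl => ?_
      rw [Finset.mem_Ico] at hl
      congr 1
      simp only [hy, hy', esig]
      split_ifs with h
      · unfold sig; rw [h3 l (by omega) (by omega), h3 (l+1) (by omega) (by omega)]
      · rfl
    obtain ⟨m, rfl⟩ : ∃ m, j' = m + 1 := ⟨j' - 1, by omega⟩
    have e3 : ∑ l ∈ Finset.Ico j (m+1), w l * y l
        = w j * y j + ∑ l ∈ Finset.Ico j m, w (l+1) * y' l := by
      rw [Finset.sum_eq_sum_Ico_succ_bot (by omega), ← Finset.sum_Ico_add' (fun l => w l * y l) j m 1]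
      congr 1
      refine Finset.sum_congr rfl fun l hl => ?_
      rw [Finset.mem_Ico] at hl
      congr 1
      simp only [hy, hy', esig]
      rw [if_pos (by omega), if_pos (by omega)]
      unfold sig; rw [h2 l (by omega) (by omega), h2 (l+1) (by omega) (by omega)]
    rw [e1, e2, e3, Finset.sum_Ico_succ_top (by omega : j ≤ m)]
    simp only [sub_mul, Finset.sum_sub_distrib, Nat.add_sub_cancel]
    ring
  rw [gen (fun l => (l:ℤ))] at hS'
  rw [gen (fun _ => 1)] at hW'
  have bX : ∀ l, 0 ≤ y' l ∧ y' l ≤ 1 := by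
    intro l; rcases esig01 t v l with h | h <;> rw [hy', h] <;> simp
  have yj : y j = if u j ≤ v j then 1 else 0 := by
    simp only [hy, esig]; rw [if_pos (by omega)]; unfold sig
    rw [h2 j le_rfl hjj]; split_ifs <;> simp
  have yj' : y' (j'-1) = if v (j'-1) ≤ v j' then 1 else 0 := by
    simp only [hy', esig]; rw [if_pos (by omega)]; unfold sig
    rw [show j' - 1 + 1 = j' by omega]; split_ifs <;> simp
  have ea : y (j-1) = if 1 < j then (if v (j-1) ≤ u j then 1 else 0) else 0 := by
    clear ha
    simp only [hy, esig]
    split_ifs <;> first | omega | (unfold sig; rw [h1 (j-1) (by omega) (by omega), show j - 1 + 1 = j by omega]; simp [*])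
  have eb : y' (j-1) = if 1 < j then (if v (j-1) ≤ v j then 1 else 0) else 0 := by
    simp only [hy', esig]
    split_ifs <;> first | omega | (unfold sig; rw [show j - 1 + 1 = j by omega]; simp [*])
  have ec : y j' = if j' < t then (if v (j'-1) ≤ v (j'+1) then 1 else 0) else 0 := by
    have := h2 (j'-1) (by omega) (by omega)
    rw [show j' - 1 + 1 = j' by omega] at this
    simp only [hy, esig]
    split_ifs <;> first | omega | (unfold sig; rw [this, h3 (j'+1) (by omega) (by omega)]; simp [*])
  have ed : y' j' = if j' < t then (if v j' ≤ v (j'+1) then 1 else 0) else 0 := by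
    simp only [hy', esig]
    split_ifs <;> first | omega | (unfold sig; simp [*])
  set X := ∑ l ∈ Finset.Ico j (j'-1), y' l with hX
  have hX0 : 0 ≤ X := Finset.sum_nonneg fun l _ => (bX l).1
  have hX1 : X ≤ ((j'-1-j : ℕ) : ℤ) := by
    calc X ≤ ∑ l ∈ Finset.Ico j (j'-1), (1:ℤ) := Finset.sum_le_sum fun l _ => (bX l).2
      _ = _ := by simp
  have c5 : y j = 1 → y' (j'-1) = 1 → X ≤ (j':ℤ) - j - 2 := by
    intro hA hB
    by_contra hlt
    have hXe : X = ((j'-1-j : ℕ) : ℤ) := by omega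
    have hall : ∀ l ∈ Finset.Ico j (j'-1), y' l = 1 := by
      refine (Finset.sum_eq_sum_iff_of_le fun l _ => (bX l).2).mp ?_
      rw [← hX, hXe]; simp
    have mono : ∀ d, j + d ≤ j' - 1 → v j ≤ v (j+d) := by
      intro d
      induction d with
      | zero => intro _; exact le_rfl
      | succ d ih =>
        intro hd
        have h := hall (j+d) (by rw [Finset.mem_Ico]; omega)
        simp only [hy', esig] at h
        rw [if_pos (by omega)] at h
        unfold sig at h
        have : v (j+d) ≤ v (j+d+1) := by
          by_contra hc; rw [if_neg hc] at h; simp at h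
        exact (ih (by omega)).trans this
    have hm := mono (j'-1-j) (by omega)
    rw [show j + (j'-1-j) = j'-1 by omega] at hm
    rw [yj] at hA; rw [yj'] at hB
    have q1 : u j ≤ v j := by by_contra hc; rw [if_neg hc] at hA; simp at hA
    have q2 : v (j'-1) ≤ v j' := by by_contra hc; rw [if_neg hc] at hB; simp at hB
    omega
  have c6 : y j = 0 → y' (j'-1) = 0 → 1 ≤ X := by
    intro hA hB
    by_contra hlt
    have hXe : X = 0 := by omega
    have hall : ∀ l ∈ Finset.Ico j (j'-1), y' l = 0 :=
      (Finset.sum_eq_zero_iff_of_nonneg fun l _ => (bX l).1).mp hXe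
    have mono : ∀ d, j + d ≤ j' - 1 → v (j+d) ≤ v j := by
      intro d
      induction d with
      | zero => intro _; exact le_rfl
      | succ d ih =>
        intro hd
        have h := hall (j+d) (by rw [Finset.mem_Ico]; omega)
        simp only [hy', esig] at h
        rw [if_pos (by omega)] at h
        unfold sig at h
        have : ¬ v (j+d) ≤ v (j+d+1) := by
          intro hc; rw [if_pos hc] at h; simp at h
        have := ih (by omega)
        rw [← add_assoc]; omega
    have hm := mono (j'-1-j) (by omega)
    rw [show j + (j'-1-j) = j'-1 by omega] at hm
    rw [yj] at hA; rw [yj'] at hB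
    have q1 : ¬ u j ≤ v j := by intro hc; rw [if_pos hc] at hA; simp at hA
    have q2 : ¬ v (j'-1) ≤ v j' := by intro hc; rw [if_pos hc] at hB; simp at hB
    omega
  refine arith_core P j j' X (y (j-1)) (y j) (y j') (y' (j-1)) (y' (j'-1)) (y' j')
    (by omega) (by omega) (esig01 _ _ _) (esig01 _ _ _) (esig01 _ _ _) (esig01 _ _ _)
    (esig01 _ _ _) (esig01 _ _ _) hX0 (by omega) ?_ ?_ ?_ ?_ c5 c6 ?_ ?_
  · rw [yj, ea, eb]; split_ifs <;> first | omega | simp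
  · rw [yj, ea, eb]; split_ifs <;> first | omega | simp
  · rw [yj', ec, ed]; split_ifs <;> first | omega | simp
  · rw [yj', ec, ed]; split_ifs <;> first | omega | simp
  · convert hW' using 1
    simp; ring
  · convert hS' using 1
    rw [hX]; push_cast [Nat.cast_sub hj, Nat.cast_sub (show 1 ≤ j' by omega)]
    simp; ring

/-- rank within a finset -/
def rk (A : Finset ℕ) (x : ℕ) : ℕ := (A.filter (· < x)).card + 1

theorem rk_lt (A : Finset ℕ) {x y : ℕ} (hx : x ∈ A) (h : x < y) : rk A x < rk A y := by
  unfold rk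
  have : (A.filter (· < x)) ⊂ (A.filter (· < y)) := by
    rw [Finset.ssubset_iff_of_subset]
    · exact ⟨x, by simp [hx, h], by simp⟩
    · intro z; simp; intro h1 h2; exact ⟨h1, by omega⟩
  have := Finset.card_lt_card this
  omega

theorem rk_le (A : Finset ℕ) {x : ℕ} (hx : x ∈ A) : rk A x ≤ A.card := by
  unfold rk
  have : (A.filter (· < x)) ⊂ A := by
    rw [Finset.ssubset_iff_of_subset (Finset.filter_subset _ _)]
    exact ⟨x, hx, by simp⟩
  exact Finset.card_lt_card this

theorem rk_eq_of_modEq (A : Finset ℕ) (m : ℕ) (hm : A.card = m) {x y : ℕ} (hx : x ∈ A) (hy : y ∈ A)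
    (h : rk A x ≡ rk A y [MOD m]) : x = y := by
  have h1 := rk_le A hx
  have h2 := rk_le A hy
  have h3 : 1 ≤ rk A x := by unfold rk; omega
  have h4 : 1 ≤ rk A y := by unfold rk; omega
  have : rk A x = rk A y := by
    have := (Nat.modEq_iff_dvd.mp h)
    have := Int.eq_zero_of_abs_lt_dvd this (by rw [abs_lt]; omega)
    omega
  rcases lt_trichotomy x y with h | h | h
  · have := rk_lt A hx h; omega
  · exact h
  · have := rk_lt A hy h; omega

theorem beta_rk (w : ℕ → ℕ) (m i : ℕ) (hw : Set.InjOn w (Set.Icc 1 m)) (h1 : 1 ≤ i) (h2 : i ≤ m) :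
    betaProj w m i = rk ((Finset.Icc 1 m).image w) (w i) := by
  unfold betaProj rk
  congr 1
  · rw [Finset.filter_image, Finset.card_image_of_injOn]
    intro a ha b hb hab
    simp at ha hb
    exact hw (by simp; omega) (by simp; omega) hab
  · rw [Finset.card_eq_one]
    refine ⟨i, ?_⟩
    ext z
    simp only [Finset.mem_filter, Finset.mem_Icc, Finset.mem_singleton]
    constructor
    · rintro ⟨h, e⟩; exact hw (by simp; omega) (by simp; omega) e
    · rintro rfl; exact ⟨by omega, rfl⟩

theorem rowSumBeta_congr (s P : ℕ) (hs : 1 ≤ s) (v w : ℕ → ℕ)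
    (h : ∀ x, 1 ≤ x → x ≤ 2*P*s → v x = w x) : rowSumBeta s P v = rowSumBeta s P w := by
  unfold rowSumBeta
  refine Finset.sum_congr rfl fun i hi => ?_
  rw [Finset.mem_range] at hi
  have hb : i * s + 1 ≤ 2*P*s := by
    have : (i+1)*s ≤ 2*P*s := Nat.mul_le_mul_right _ hi
    nlinarith
  unfold betaProj
  rw [h (i*s+1) (by omega) hb]
  congr 2
  · refine Finset.filter_congr fun x hx => ?_
    rw [Finset.mem_Icc] at hx; rw [h x hx.1 hx.2]
  · refine Finset.filter_congr fun x hx => ?_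
    rw [Finset.mem_Icc] at hx; rw [h x hx.1 (by omega)]

theorem sum_isolate (N q m c : ℕ) (hq : q ∈ Finset.Icc 1 N) (f g : ℕ → ℕ)
    (hfg : ∀ x ∈ Finset.Icc 1 N, x ≠ q → f x = g x)
    (hf : ∑ x ∈ Finset.Icc 1 N, f x ≡ c [MOD m]) (hg : ∑ x ∈ Finset.Icc 1 N, g x ≡ c [MOD m]) :
    f q ≡ g q [MOD m] := by
  rw [← Finset.add_sum_erase _ _ hq] at hf hg
  have : ∑ x ∈ (Finset.Icc 1 N).erase q, f x = ∑ x ∈ (Finset.Icc 1 N).erase q, g x :=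
    Finset.sum_congr rfl fun x hx => by
      rw [Finset.mem_erase] at hx; exact hfg x hx.2 hx.1
  rw [this] at hf
  exact Nat.ModEq.add_right_cancel' _ (hf.trans hg.symm)

theorem pairBlk_agree (L nb B k n : ℕ) (σ τ : ℕ → ℕ) (hn : n = nb * L) (hnb : 0 < nb)
    (hag : ∀ x, 1 ≤ x → x ≤ n → (x ≤ B*L ∨ (B+2)*L < x) → σ x = τ x)
    (hk1 : (k-1) % nb ≠ B ∧ (k-1) % nb ≠ B+1) (hk2 : k % nb ≠ B ∧ k % nb ≠ B+1)
    (x : ℕ) (h1 : 1 ≤ x) (h2 : x ≤ 2*L) : pairBlk σ L nb k x = pairBlk τ L nb k x := by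
  have key : ∀ r y, r < nb → r ≠ B ∧ r ≠ B+1 → 1 ≤ y → y ≤ L → σ (r*L+y) = τ (r*L+y) := by
    intro r y hr hB hy1 hy2
    have q1 : (r+1)*L ≤ nb*L := Nat.mul_le_mul_right _ hr
    have q2 : (r+1)*L = r*L+L := by ring
    apply hag _ (by omega) (by omega)
    rcases Nat.lt_or_ge r B with h | h
    · left
      have : (r+1)*L ≤ B*L := Nat.mul_le_mul_right _ h
      omega
    · right
      have : (B+2)*L ≤ r*L := Nat.mul_le_mul_right _ (by omega)
      omega
  unfold pairBlk blockAt
  split_ifs with h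
  · exact key _ _ (Nat.mod_lt _ hnb) hk1 h1 h
  · exact key _ _ (Nat.mod_lt _ hnb) (by simpa using hk2) (by omega) (by omega)

theorem window_modEq (n s P c1 c2 B nb : ℕ) (σ τ : ℕ → ℕ) (hs : 1 ≤ s) (hP : 2 ≤ P)
    (hn : n = 2 * nb * (P*s)) (hB : B + 2 ≤ 2 * nb)
    (hσ : CRetrieve n s P c1 c2 σ) (hτ : CRetrieve n s P c1 c2 τ)
    (hag : ∀ x, 1 ≤ x → x ≤ n → (x ≤ B*(P*s) ∨ (B+2)*(P*s) < x) → σ x = τ x) :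
    rowSumBeta s P (fun x => σ (B*(P*s)+x)) ≡ rowSumBeta s P (fun x => τ (B*(P*s)+x)) [MOD 2*P*s] := by
  have hL : 0 < P*s := by positivity
  have d1 : n / (2*P*s) = nb := by
    rw [hn, show 2*nb*(P*s) = nb*(2*P*s) by ring]
    exact Nat.mul_div_cancel _ (by rw [mul_assoc]; omega)
  have d2 : n / (P*s) = 2*nb := by rw [hn]; exact Nat.mul_div_cancel _ hL
  unfold CRetrieve at hσ hτ
  rw [d1, d2] at hσ hτ
  have conv : ∀ ρ : ℕ → ℕ, rowSumBeta s P (pairBlk ρ (P*s) (2*nb) (B+1))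
      = rowSumBeta s P (fun x => ρ (B*(P*s)+x)) := by
    intro ρ
    apply rowSumBeta_congr s P hs
    intro x h1 h2
    unfold pairBlk blockAt
    rw [show B+1-1 = B by omega, show B+1+1-1 = B+1 by omega, Nat.mod_eq_of_lt (by omega),
      Nat.mod_eq_of_lt (by omega)]
    split_ifs with h
    · rfl
    · congr 1
      rw [add_mul]; omega
  rw [← conv, ← conv]
  have agr : ∀ k, ((k-1) % (2*nb) ≠ B ∧ (k-1) % (2*nb) ≠ B+1) → (k % (2*nb) ≠ B ∧ k % (2*nb) ≠ B+1) →
      rowSumBeta s P (pairBlk σ (P*s) (2*nb) k) = rowSumBeta s P (pairBlk τ (P*s) (2*nb) k) := by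
    intro k hk1 hk2
    apply rowSumBeta_congr s P hs
    intro x h1 h2
    exact pairBlk_agree (P*s) (2*nb) B k n σ τ hn (by omega) hag hk1 hk2 x h1 (by rw [← mul_assoc]; exact h2)
  rcases Nat.even_or_odd' B with ⟨r, hr | hr⟩
  · have := sum_isolate nb (r+1) (2*P*s) c1 (by rw [Finset.mem_Icc]; omega)
      (fun i => rowSumBeta s P (pairBlk σ (P*s) (2*nb) (2*i-1)))
      (fun i => rowSumBeta s P (pairBlk τ (P*s) (2*nb) (2*i-1))) ?_ hσ.1 hτ.1
    · simp only [show 2*(r+1)-1 = B+1 by omega] at this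
      exact this
    · intro x hx hne
      rw [Finset.mem_Icc] at hx
      apply agr
      · rw [Nat.mod_eq_of_lt (by omega)]; omega
      · rw [Nat.mod_eq_of_lt (by omega)]; omega
  · have := sum_isolate nb (r+1) (2*P*s) c2 (by rw [Finset.mem_Icc]; omega)
      (fun i => rowSumBeta s P (pairBlk σ (P*s) (2*nb) (2*i)))
      (fun i => rowSumBeta s P (pairBlk τ (P*s) (2*nb) (2*i))) ?_ hσ.2 hτ.2
    · simp only [show 2*(r+1) = B+1 by omega] at this
      exact this
    · intro x hx hne
      rw [Finset.mem_Icc] at hx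
      apply agr
      · rw [Nat.mod_eq_of_lt (by omega)]; omega
      · rcases Nat.lt_or_ge x nb with h | h
        · rw [Nat.mod_eq_of_lt (by omega)]; omega
        · have : x = nb := by omega
          rw [this, Nat.mod_self]; omega

theorem image_window (n a m : ℕ) (σ τ : ℕ → ℕ) (ham : a + m ≤ n)
    (hσ : Set.BijOn σ (Set.Icc 1 n) (Set.Icc 1 n)) (hτ : Set.BijOn τ (Set.Icc 1 n) (Set.Icc 1 n))
    (hag : ∀ x, 1 ≤ x → x ≤ n → (x ≤ a ∨ a + m < x) → σ x = τ x) :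
    (Finset.Icc 1 m).image (fun x => σ (a+x)) ⊆ (Finset.Icc 1 m).image (fun x => τ (a+x)) := by
  intro z hz
  simp only [Finset.mem_image, Finset.mem_Icc] at hz ⊢
  obtain ⟨x, hx, rfl⟩ := hz
  have hm : a + x ∈ Set.Icc 1 n := by simp; omega
  obtain ⟨w, hw, hwe⟩ := hτ.surjOn (hσ.mapsTo hm)
  have hw' := hw
  simp only [Set.mem_Icc] at hw'
  by_cases h : w ≤ a ∨ a + m < w
  · have := hσ.injOn hw hm ((hag w hw'.1 hw'.2 h).trans hwe)
    omega
  · exact ⟨w - a, by omega, by rw [show a + (w-a) = w by omega]; exact hwe⟩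

theorem rowSum_rk (n s P B : ℕ) (σ : ℕ → ℕ) (hs : 1 ≤ s) (hB : B*(P*s) + 2*P*s ≤ n)
    (hσ : Set.BijOn σ (Set.Icc 1 n) (Set.Icc 1 n)) :
    rowSumBeta s P (fun x => σ (B*(P*s)+x))
     = ∑ l ∈ Finset.Ico (B*P+1) (B*P+1+2*P),
        rk ((Finset.Icc 1 (2*P*s)).image (fun x => σ (B*(P*s)+x))) (row1 s σ l) := by
  rw [Finset.sum_Ico_eq_sum_range]
  unfold rowSumBeta
  rw [show B*P+1+2*P-(B*P+1) = 2*P by omega]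
  refine Finset.sum_congr rfl fun c hc => ?_
  rw [Finset.mem_range] at hc
  have hb : c * s + 1 ≤ 2*P*s := by
    have : (c+1)*s ≤ 2*P*s := Nat.mul_le_mul_right _ hc
    nlinarith
  rw [beta_rk _ _ _ _ (by omega) hb]
  · congr 1
    unfold row1
    rw [show B*P+1+c-1 = B*P+c by omega]
    congr 1; ring
  · intro x hx y hy hxy
    simp only [Set.mem_Icc] at hx hy
    have := hσ.injOn (x₁ := B*(P*s)+x) (x₂ := B*(P*s)+y) (by simp; omega) (by simp; omega) hxy
    omega

theorem main_le (s t n : ℕ) (hs : 1 ≤ s) (hn : n = s * t)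
    (P : ℕ) (hP : 2 ≤ P) (hdvd : 2*P*s ∣ n)
    (c1 c2 : ℕ) (σ τ : ℕ → ℕ)
    (hσ : Set.BijOn σ (Set.Icc 1 n) (Set.Icc 1 n))
    (hτ : Set.BijOn τ (Set.Icc 1 n) (Set.Icc 1 n))
    (hretσ : CRetrieve n s P c1 c2 σ) (hretτ : CRetrieve n s P c1 c2 τ)
    (hS : (∑ i ∈ Finset.Icc 1 (t-1), i * sig (row1 s σ) i) ≡
      (∑ i ∈ Finset.Icc 1 (t-1), i * sig (row1 s τ) i) [MOD P])
    (hW : (∑ i ∈ Finset.Icc 1 (t-1), sig (row1 s σ) i) ≡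
      (∑ i ∈ Finset.Icc 1 (t-1), sig (row1 s τ) i) [MOD 2])
    (i i' : ℕ) (hi : 1 ≤ i) (hi2 : i + s - 1 ≤ n)
    (hi' : 1 ≤ i') (hi2' : i' + s - 1 ≤ n)
    (hdel : BurstDelEq n s σ τ i i')
    (j j' : ℕ) (hj : 1 ≤ j) (hj' : 1 ≤ j')
    (hk : i ≤ (j-1)*s+1 ∧ (j-1)*s+1 ≤ i + s - 1)
    (hk' : i' ≤ (j'-1)*s+1 ∧ (j'-1)*s+1 ≤ i' + s - 1)
    (hjj : j ≤ j') (hclose : j' - j ≤ P - 1) :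
    (∀ i ∈ Finset.Icc 1 t, row1 s σ i = row1 s τ i) ∧ j = j' := by
  obtain ⟨nb, hnb⟩ := hdvd
  have hn2 : n = 2 * nb * (P*s) := by rw [hnb]; ring
  have ht : t = 2 * nb * P := by
    have : s * t = s * (2*nb*P) := by rw [← hn, hn2]; ring
    exact Nat.eq_of_mul_eq_mul_left hs this
  have hj't : j' ≤ t := by
    by_contra h
    have : t * s ≤ (j'-1)*s := Nat.mul_le_mul_right _ (by omega)
    rw [mul_comm t s] at this
    omega
  -- relation of the rows
  have rowrel : ∀ l, 1 ≤ l → l < t →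
      (if l < j then row1 s σ l else row1 s σ (l+1)) = (if l < j' then row1 s τ l else row1 s τ (l+1)) := by
    intro l hl1 hl2
    have cmp : ∀ i j, 1 ≤ j → i ≤ (j-1)*s+1 → (j-1)*s+1 ≤ i+s-1 → ((l-1)*s+1 < i ↔ l < j) := by
      intro i j hj h1 h2
      constructor
      · intro h
        by_contra hc
        have : (j-1)*s ≤ (l-1)*s := Nat.mul_le_mul_right _ (by omega)
        omega
      · intro h
        have : (l-1+1)*s ≤ (j-1)*s := Nat.mul_le_mul_right _ (by omega)
        rw [add_mul] at this
        omega
    have hle : (l-1)*s+1 ≤ n - s := by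
      have : (l-1+1+1)*s ≤ t*s := Nat.mul_le_mul_right _ (by omega)
      rw [add_mul, add_mul, mul_comm t s] at this
      omega
    have := hdel ((l-1)*s+1) (by rw [Finset.mem_Icc]; omega)
    rw [if_congr (cmp i j hj hk.1 hk.2) rfl rfl, if_congr (cmp i' j' hj' hk'.1 hk'.2) rfl rfl] at this
    have e : (l-1)*s+1+s = (l+1-1)*s+1 := by
      obtain ⟨m, rfl⟩ : ∃ m, l = m+1 := ⟨l-1, by omega⟩
      simp; ring
    rw [e] at this
    exact this
  have h1 : ∀ l, 1 ≤ l → l < j → row1 s σ l = row1 s τ l := by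
    intro l a b
    have := rowrel l a (by omega)
    rwa [if_pos b, if_pos (by omega)] at this
  have h2 : ∀ l, j ≤ l → l < j' → row1 s σ (l+1) = row1 s τ l := by
    intro l a b
    have := rowrel l (by omega) (by omega)
    rwa [if_neg (by omega), if_pos (by omega)] at this
  have h3 : ∀ l, j' < l → l ≤ t → row1 s σ l = row1 s τ l := by
    intro l a b
    have := rowrel (l-1) (by omega) (by omega)
    rwa [if_neg (by omega), if_neg (by omega), show l-1+1 = l by omega] at this
  -- the window
  obtain ⟨B, hB1, hB2, hB3⟩ : ∃ B, B + 2 ≤ 2*nb ∧ B*P ≤ j-2 ∧ j' ≤ (B+2)*P := by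
    have hnb0 : 1 ≤ nb := by
      rcases Nat.eq_zero_or_pos nb with h | h
      · subst h; simp at ht; omega
      · exact h
    have hd := Nat.div_add_mod (j-2) P
    have hm := Nat.mod_lt (j-2) (show P > 0 by omega)
    set q := (j-2)/P
    rcases Nat.lt_or_ge (q+1) (2*nb) with h | h
    · refine ⟨q, by omega, by rw [mul_comm]; omega, ?_⟩
      rw [add_mul, mul_comm q P]; omega
    · refine ⟨2*nb-2, by omega, ?_, ?_⟩
      · have : (2*nb-2)*P ≤ q*P := Nat.mul_le_mul_right _ (by omega)
        rw [mul_comm q P] at this; omega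
      · rw [show 2*nb-2+2 = 2*nb by omega]; omega
  have hag : ∀ x, 1 ≤ x → x ≤ n → (x ≤ B*(P*s) ∨ (B+2)*(P*s) < x) → σ x = τ x := by
    intro x hx1 hx2 hx
    rcases hx with hx | hx
    · have q1 : B*P*s ≤ (j-2)*s := Nat.mul_le_mul_right _ hB2
      rw [← mul_assoc] at hx
      have hj2 : 2 ≤ j := by
        by_contra h
        have : j - 2 = 0 := by omega
        rw [this] at q1; omega
      have q2 : (j-1)*s = (j-2)*s+s := by
        rw [show j-1 = j-2+1 by omega, add_mul]; omega
      have q3 : (j-1)*s ≤ (j'-1)*s := Nat.mul_le_mul_right _ (by omega)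
      have := hdel x (by rw [Finset.mem_Icc]; omega)
      rwa [if_pos (by omega), if_pos (by omega)] at this
    · have q1 : j'*s ≤ (B+2)*P*s := Nat.mul_le_mul_right _ hB3
      rw [← mul_assoc] at hx
      have q2 : j'*s = (j'-1)*s+s := by
        conv_lhs => rw [show j' = j'-1+1 by omega, add_mul]
        omega
      have q3 : (j-1)*s ≤ (j'-1)*s := Nat.mul_le_mul_right _ (by omega)
      have := hdel (x-s) (by rw [Finset.mem_Icc]; omega)
      rwa [if_neg (by omega), if_neg (by omega), show x - s + s = x by omega] at this
  have hwin : B*(P*s) + 2*P*s ≤ n := by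
    rw [hn2]
    calc B*(P*s) + 2*P*s = (B+2)*(P*s) := by ring
      _ ≤ _ := Nat.mul_le_mul_right _ hB1
  have hag' : ∀ x, 1 ≤ x → x ≤ n → (x ≤ B*(P*s) ∨ B*(P*s) + 2*P*s < x) → σ x = τ x := by
    rw [show B*(P*s) + 2*P*s = (B+2)*(P*s) by ring]; exact hag
  have hA := (image_window n _ _ σ τ hwin hσ hτ hag').antisymm
    (image_window n _ _ τ σ hwin hτ hσ (fun x a b c => (hag' x a b c).symm))
  have hmod := window_modEq n s P c1 c2 B nb σ τ hs hP hn2 hB1 hretσ hretτ hag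
  rw [rowSum_rk n s P B σ hs hwin hσ, rowSum_rk n s P B τ hs hwin hτ, ← hA] at hmod
  set A := (Finset.Icc 1 (2*P*s)).image (fun x => σ (B*(P*s)+x)) with hAdef
  have hmv := sum_move (B*P+1) (B*P+1+2*P) j j' (fun l => rk A (row1 s σ l)) (fun l => rk A (row1 s τ l))
    (by omega) hjj (by rw [add_mul] at hB3; omega)
    (fun l a b => by rw [h1 l (by omega) b])
    (fun l a b => by rw [h2 l a b])
    (fun l a b => by
      have : (B+2)*P ≤ 2*nb*P := Nat.mul_le_mul_right _ hB1
      rw [add_mul] at this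
      rw [h3 l a (by omega)])
  have hrk : rk A (row1 s σ j) ≡ rk A (row1 s τ j') [MOD 2*P*s] := by
    have := hmod.symm.add_right (rk A (row1 s σ j))
    rw [← hmv] at this
    exact Nat.ModEq.add_left_cancel' _ this.symm
  have hcard : A.card = 2*P*s := by
    rw [hAdef, Finset.card_image_of_injOn]
    · simp
    · intro x hx y hy hxy
      simp only [Finset.coe_Icc, Set.mem_Icc] at hx hy
      have := hσ.injOn (x₁ := B*(P*s)+x) (x₂ := B*(P*s)+y) (by simp; omega) (by simp; omega) hxy
      omega
  have inA : ∀ ρ : ℕ → ℕ, ∀ l, B*P+1 ≤ l → l ≤ (B+2)*P →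
      row1 s ρ l ∈ (Finset.Icc 1 (2*P*s)).image (fun x => ρ (B*(P*s)+x)) := by
    intro ρ l a b
    rw [Finset.mem_image]
    have q : (l-1-B*P+1)*s ≤ 2*P*s := Nat.mul_le_mul_right _ (by rw [add_mul] at b; omega)
    rw [add_mul] at q
    refine ⟨(l-1-B*P)*s+1, by rw [Finset.mem_Icc]; omega, ?_⟩
    unfold row1
    congr 1
    conv_rhs => rw [show l - 1 = B*P + (l-1-B*P) by omega]
    ring
  have ha : row1 s σ j = row1 s τ j' := by
    refine rk_eq_of_modEq A _ hcard (inA σ j (by omega) (by omega)) ?_ hrk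
    rw [hA]
    exact inA τ j' (by omega) hB3
  have hjeq : j = j' := by
    by_contra hne
    refine svt_core t P j j' (row1 s σ) (row1 s τ) hj (by omega) hj't hclose hP h1 h2 h3 ha ?_ hS hW
    intro h
    unfold row1 at h
    have q1 : (j'-1+1)*s ≤ t*s := Nat.mul_le_mul_right _ (by omega)
    have q2 : (j-1+1)*s ≤ (j'-1)*s := Nat.mul_le_mul_right _ (by omega)
    rw [add_mul, mul_comm t s] at q1
    rw [add_mul] at q2
    have := hτ.injOn (by rw [Set.mem_Icc]; omega) (by rw [Set.mem_Icc]; omega) h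
    omega
  refine ⟨?_, hjeq⟩
  intro l hl
  rw [Finset.mem_Icc] at hl
  rcases lt_trichotomy l j with h | h | h
  · exact h1 l hl.1 h
  · rw [h, ha, hjeq]
  · exact h3 l (by omega) hl.2

/-- Lemma: for permutations in the PSVT code, the first row is recovered
and the exact erroneous column is located. -/
theorem stmt12 (s t n : ℕ) (hs : 1 ≤ s) (hn : n = s * t)
    (P : ℕ) (hP : 2 ≤ P) (hdvd : 2*P*s ∣ n)
    (b1 : ℕ) (hb1 : b1 < P) (b2 : ℕ) (hb2 : b2 < 2)
    (c1 c2 : ℕ) (hc1 : c1 < 2*P*s) (hc2 : c2 < 2*P*s)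
    (σ τ : ℕ → ℕ)
    (hσperm : Set.BijOn σ (Set.Icc 1 n) (Set.Icc 1 n))
    (hτperm : Set.BijOn τ (Set.Icc 1 n) (Set.Icc 1 n))
    (hretσ : CRetrieve n s P c1 c2 σ) (hretτ : CRetrieve n s P c1 c2 τ)
    -- first-row signatures in SVT_{b1,b2}(t−1, P)
    (hSVTσ : (∑ i ∈ Finset.Icc 1 (t-1), i * sig (row1 s σ) i) ≡ b1 [MOD P]
      ∧ (∑ i ∈ Finset.Icc 1 (t-1), sig (row1 s σ) i) ≡ b2 [MOD 2])
    (hSVTτ : (∑ i ∈ Finset.Icc 1 (t-1), i * sig (row1 s τ) i) ≡ b1 [MOD P]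
      ∧ (∑ i ∈ Finset.Icc 1 (t-1), sig (row1 s τ) i) ≡ b2 [MOD 2])
    (i i' : ℕ) (hi : 1 ≤ i) (hi2 : i + s - 1 ≤ n)
    (hi' : 1 ≤ i') (hi2' : i' + s - 1 ≤ n)
    (hdel : BurstDelEq n s σ τ i i')
    (k k' j j' : ℕ)
    (hk : i ≤ k ∧ k ≤ i + s - 1 ∧ k % s = 1 % s)
    (hk' : i' ≤ k' ∧ k' ≤ i' + s - 1 ∧ k' % s = 1 % s)
    (hj : j = (k-1)/s + 1) (hj' : j' = (k'-1)/s + 1)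
    (hclose : |(j : ℤ) - (j' : ℤ)| ≤ (P : ℤ) - 1) :
    (∀ i ∈ Finset.Icc 1 t, row1 s σ i = row1 s τ i) ∧ j = j' := by
  have colk : ∀ k j, 1 ≤ k → k % s = 1 % s → j = (k-1)/s + 1 → k = (j-1)*s+1 := by
    intro k j hk1 hm hj
    have hd : s ∣ k - 1 := (Nat.modEq_iff_dvd' hk1).mp (show 1 % s = k % s from hm.symm)
    rw [hj, Nat.add_sub_cancel, Nat.div_mul_cancel hd]; omega
  have ek := colk k j (by omega) hk.2.2 hj
  have ek' := colk k' j' (by omega) hk'.2.2 hj'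
  have hk2 := And.intro hk.1 hk.2.1
  have hk2' := And.intro hk'.1 hk'.2.1
  rw [ek] at hk2
  rw [ek'] at hk2'
  rw [abs_le] at hclose
  have j1 : 1 ≤ j := by rw [hj]; exact Nat.le_add_left _ _
  have j1' : 1 ≤ j' := by rw [hj']; exact Nat.le_add_left _ _
  rcases Nat.le_total j j' with h | h
  · exact main_le s t n hs hn P hP hdvd c1 c2 σ τ hσperm hτperm hretσ hretτ
      (hSVTσ.1.trans hSVTτ.1.symm) (hSVTσ.2.trans hSVTτ.2.symm) i i' hi hi2 hi' hi2' hdel j j'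
      j1 j1' hk2 hk2' h (by omega)
  · have := main_le s t n hs hn P hP hdvd c1 c2 τ σ hτperm hσperm hretτ hretσ
      (hSVTτ.1.trans hSVTσ.1.symm) (hSVTτ.2.trans hSVTσ.2.symm) i' i hi' hi2' hi hi2
      (fun x hx => (hdel x hx).symm) j' j j1' j1 hk2' hk2 h (by omega)
    exact ⟨fun x hx => (this.1 x hx).symm, this.2.symm⟩


end Stmt
end

section
/- Let n ≥ 2 and let a ∈ {0,1,…,n−1}. For every permutation π = (π_1,…,π_{n−1}) of {1,…,n−1}, there exists j ∈ {0,1,…,n−1} such that the permutation σ = (π_1,…,π_j, n, π_{j+1},…,π_{n−1}) of {1,…,n} satisfies Σ_{i=1}^{n−1} i·α(σ)_i ≡ a (mod n). Consequently, there is an encoding of S_{n−1} into Levenshtein's single stable deletion correcting permutation code C_a(n) = {σ ∈ S_n : Σ_{i=1}^{n−1} i·α(σ)_i ≡ a (mod n)} by inserting the symbol n at a suitable position. -/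
namespace Stmt

/-- The offset obtained by inserting the maximum after position `j` covers every value. -/
lemma cover (x : ℕ → ℕ) (hx : ∀ i, x i = 0 ∨ x i = 1) (N : ℕ) :
    ∀ t ≤ N, ∃ j ≤ N, (if x j = 1 then 0 else j) + ∑ i ∈ Finset.Ioc j N, x i = t := by
  induction N with
  | zero =>
    intro t ht
    exact ⟨0, le_rfl, by simp; omega⟩
  | succ N ih =>
    intro t ht
    rcases hx (N+1) with h | h
    · by_cases ht' : t = N + 1
      · exact ⟨N+1, le_rfl, by simp [h, ht']⟩
      · obtain ⟨j, hj, hj'⟩ := ih t (by omega)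
        refine ⟨j, by omega, ?_⟩
        rw [Finset.sum_Ioc_succ_top hj, h]
        omega
    · by_cases ht' : t = 0
      · exact ⟨N+1, le_rfl, by simp [h, ht']⟩
      · obtain ⟨j, hj, hj'⟩ := ih (t-1) (by omega)
        refine ⟨j, by omega, ?_⟩
        rw [Finset.sum_Ioc_succ_top hj, h]
        omega

lemma sig_lt (π : ℕ → ℕ) (j v i : ℕ) (h : i < j) : sig (insSeq π j v) i = sig π i := by
  have h1 : i ≤ j := h.le
  have h2 : i + 1 ≤ j := h
  simp [sig, insSeq, h1, h2]

lemma sig_gt (π : ℕ → ℕ) (j v i : ℕ) (h : j < i) :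
    sig (insSeq π j v) (i + 1) = sig π i := by
  have h1 : ¬ i + 1 ≤ j := by omega
  have h2 : ¬ i + 1 + 1 ≤ j := by omega
  have h3 : i ≠ j := by omega
  have h4 : i + 1 ≠ j := by omega
  simp [sig, insSeq, h1, h2, h3, h4]

lemma sig_eq (π : ℕ → ℕ) (j v : ℕ) (h : π j ≤ v) : sig (insSeq π j v) j = 1 := by
  simp [sig, insSeq, h]

lemma sig_next (π : ℕ → ℕ) (j v : ℕ) (h : π (j+1) < v) :
    sig (insSeq π j v) (j+1) = 0 := by
  simp [sig, insSeq, h]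

lemma sum_top (π : ℕ → ℕ) (j v : ℕ) (h : 1 ≤ j → π j ≤ v) :
    ∑ i ∈ Finset.range (j+1), i * sig (insSeq π j v) i
      = ∑ i ∈ Finset.range j, i * sig π i + j := by
  rw [Finset.sum_range_succ]
  congr 1
  · exact Finset.sum_congr rfl fun i hi => by rw [sig_lt _ _ _ _ (Finset.mem_range.1 hi)]
  · rcases Nat.eq_zero_or_pos j with h0 | h0
    · subst h0; simp
    · rw [sig_eq _ _ _ (h h0), mul_one]

lemma sum_ins (π : ℕ → ℕ) (j v N : ℕ) (hN : j ≤ N) (h : 1 ≤ j → π j ≤ v)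
    (h' : π (j+1) < v) :
    ∑ i ∈ Finset.range (N+2), i * sig (insSeq π j v) i
      = ∑ i ∈ Finset.range (N+1), i * sig π i
        + ((if sig π j = 1 then 0 else j) + ∑ i ∈ Finset.Ioc j N, sig π i) := by
  induction N, hN using Nat.le_induction with
  | base =>
    rw [Finset.sum_range_succ, sum_top _ _ _ h, sig_next _ _ _ h', Finset.sum_range_succ]
    have : sig π j = 0 ∨ sig π j = 1 := by unfold sig; split_ifs <;> simp
    rcases this with h | h <;> simp [h]
  | succ N hN ih =>
    rw [Finset.sum_range_succ, ih, sig_gt _ _ _ _ (by omega : j < N + 1),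
      Finset.sum_range_succ _ (N+1), Finset.sum_Ioc_succ_top hN]
    ring

/-- Theorem: every permutation of {1,…,n−1} can be encoded into
Levenshtein's code C_a(n) by inserting the symbol n at a suitable position. -/
theorem stmt15 (n : ℕ) (hn : 2 ≤ n) (a : ℕ) (ha : a < n)
    (π : ℕ → ℕ) (hπ : Set.BijOn π (Set.Icc 1 (n-1)) (Set.Icc 1 (n-1))) :
    ∃ j ≤ n - 1,
      (∑ i ∈ Finset.Icc 1 (n-1), i * sig (insSeq π j n) i) ≡ a [MOD n] := by
  obtain ⟨m, rfl⟩ : ∃ m, n = m + 2 := ⟨n - 2, by omega⟩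
  have e : m + 2 - 1 = m + 1 := rfl
  rw [e] at hπ ⊢
  have hb : ∀ i, 1 ≤ i → i ≤ m + 1 → π i < m + 2 := by
    intro i h1 h2
    have := (hπ.mapsTo (Set.mem_Icc.2 ⟨h1, h2⟩)).2
    omega
  have hs : ∀ f : ℕ → ℕ, ∑ i ∈ Finset.Icc 1 (m+1), i * f i
      = ∑ i ∈ Finset.range (m+2), i * f i := by
    intro f
    apply Finset.sum_subset
    · intro i hi
      simp only [Finset.mem_Icc, Finset.mem_range] at *
      omega
    · intro i hi hi'
      simp only [Finset.mem_Icc, Finset.mem_range] at *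
      have : i = 0 := by omega
      simp [this]
  simp only [hs]
  set M := ∑ i ∈ Finset.range (m+1), i * sig π i with hM
  obtain ⟨t, ht, hta⟩ : ∃ t, t ≤ m + 1 ∧ M + t ≡ a [MOD m + 2] := by
    refine ⟨(a + (m + 1) * M) % (m + 2),
      by have := Nat.mod_lt (a + (m + 1) * M) (show 0 < m + 2 by omega); omega, ?_⟩
    calc M + (a + (m + 1) * M) % (m + 2) ≡ M + (a + (m + 1) * M) [MOD m + 2] :=
          (Nat.mod_modEq _ _).add_left _
      _ = a + (m + 2) * M := by ring
      _ ≡ a [MOD m + 2] := by simp [Nat.ModEq]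
  by_cases htm : t = m + 1
  · refine ⟨m + 1, le_rfl, ?_⟩
    rw [sum_top π (m+1) (m+2) (fun h => (hb _ h le_rfl).le), ← htm]
    exact htm ▸ hta
  · obtain ⟨j, hj, hjt⟩ := cover (sig π) (fun i => by unfold sig; split_ifs <;> simp) m t (by omega)
    refine ⟨j, by omega, ?_⟩
    rw [sum_ins π j (m+2) m hj (fun h => (hb _ h (by omega)).le) (hb _ (by omega) (by omega)), hjt]
    exact hta

end Stmt
end

section
/- Let n ≥ 2, a ∈ {0,1,…,n−1}, and let π = (π_1,…,π_{n−1}) be a permutation of {1,…,n−1}. Set Δ = (a − Σ_{i=1}^{n−2} i·α(π)_i) mod n (so Δ ∈ {0,…,n−1}) and ω = Σ_{i=1}^{n−2} α(π)_i. Suppose 0 ≤ Δ ≤ ω−1, and let j be the position of the (ω−Δ)-th one in α(π), i.e., the unique index with α(π)_j = 1 and #{i ≤ j : α(π)_i = 1} = ω−Δ. Then the permutation σ = (π_1,…,π_j, n, π_{j+1},…,π_{n−1}) satisfies Σ_{i=1}^{n−1} i·α(σ)_i ≡ a (mod n). -/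
namespace Stmt

theorem ins_sum (π : ℕ → ℕ) (j n : ℕ) (h1 : π j ≤ n) (h2 : π (j+1) < n)
    (hjone : sig π j = 1) (k : ℕ) :
    (∑ i ∈ Finset.Icc 1 (j+1+k), i * sig (insSeq π j n) i) + ∑ i ∈ Finset.Icc 1 j, sig π i
    = (∑ i ∈ Finset.Icc 1 (j+k), i * sig π i) + ∑ i ∈ Finset.Icc 1 (j+k), sig π i := by
  induction k with
  | zero =>
    have e0 : sig (insSeq π j n) (j+1) = 0 := by
      simp [sig, insSeq, h2]
    have e1 : ∑ i ∈ Finset.Icc 1 j, i * sig (insSeq π j n) i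
        = ∑ i ∈ Finset.Icc 1 j, i * sig π i := by
      apply Finset.sum_congr rfl
      intro i hi
      rw [Finset.mem_Icc] at hi
      congr 1
      rcases Nat.lt_or_ge i j with h | h
      · have h' : i + 1 ≤ j := h
        simp [sig, insSeq, hi.2, h']
      · have : i = j := le_antisymm hi.2 h
        subst this
        rw [hjone]
        simp [sig, insSeq, h1]
    simp only [Nat.add_zero]
    rw [Finset.sum_Icc_succ_top (by omega), e0, e1]
    simp
  | succ k ih =>
    have e : sig (insSeq π j n) (j+1+k+1) = sig π (j+k+1) := by
      have a1 : ¬ (j+1+k+1 ≤ j) := by omega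
      have a2 : ¬ (j+1+k+1 = j+1) := by omega
      have a3 : ¬ (j+1+k+1+1 ≤ j) := by omega
      have a4 : ¬ (j+1+k+1+1 = j+1) := by omega
      have a5 : j+1+k+1-1 = j+k+1 := by omega
      have a6 : j+1+k+1+1-1 = j+k+1+1 := by omega
      simp only [sig, insSeq, if_neg a1, if_neg a2, if_neg a3, if_neg a4, a5, a6]
    rw [← Nat.add_assoc, ← Nat.add_assoc, Finset.sum_Icc_succ_top (by omega),
      Finset.sum_Icc_succ_top (by omega), Finset.sum_Icc_succ_top (by omega), e]
    linarith

/-- encoder correctness, case 0 ≤ Δ ≤ ω−1. -/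
theorem stmt16 (n : ℕ) (hn : 2 ≤ n) (a : ℕ) (ha : a < n)
    (π : ℕ → ℕ) (hπ : Set.BijOn π (Set.Icc 1 (n-1)) (Set.Icc 1 (n-1)))
    (Δ ω : ℕ)
    (hΔ : (Δ : ℤ) = ((a : ℤ) - ∑ i ∈ Finset.Icc 1 (n-2), (i : ℤ) * (sig π i : ℤ)) % (n : ℤ))
    (hω : ω = ∑ i ∈ Finset.Icc 1 (n-2), sig π i)
    (hcase : Δ < ω)
    (j : ℕ) (hj1 : 1 ≤ j) (hj2 : j ≤ n - 2)
    (hjone : sig π j = 1)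
    (hjcount : ((Finset.Icc 1 j).filter (fun i => sig π i = 1)).card = ω - Δ) :
    (∑ i ∈ Finset.Icc 1 (n-1), i * sig (insSeq π j n) i) ≡ a [MOD n] := by
  have m1 := (hπ.mapsTo (show j ∈ Set.Icc 1 (n-1) from ⟨hj1, by omega⟩)).2
  have m2 := (hπ.mapsTo (show j+1 ∈ Set.Icc 1 (n-1) from ⟨by omega, by omega⟩)).2
  have key := ins_sum π j n (by omega) (by omega) hjone (n-2-j)
  rw [show j+1+(n-2-j) = n-1 by omega, show j+(n-2-j) = n-2 by omega, ← hω] at key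
  have hc : ∑ i ∈ Finset.Icc 1 j, sig π i = ω - Δ := by
    rw [← hjcount, Finset.card_filter]
    apply Finset.sum_congr rfl
    intro i _
    unfold sig
    split_ifs <;> simp_all
  rw [hc] at key
  have key2 : (∑ i ∈ Finset.Icc 1 (n-1), i * sig (insSeq π j n) i)
      = (∑ i ∈ Finset.Icc 1 (n-2), i * sig π i) + Δ := by omega
  rw [key2, ← Int.natCast_modEq_iff]
  push_cast
  have hd : (Δ : ℤ) ≡ (a : ℤ) - ∑ i ∈ Finset.Icc 1 (n-2), (i : ℤ) * (sig π i : ℤ) [ZMOD n] := by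
    rw [hΔ]
    exact Int.mod_modEq _ _
  simpa using hd.add_left (∑ i ∈ Finset.Icc 1 (n-2), (i : ℤ) * (sig π i : ℤ))

end Stmt
end

section
/- Let n ≥ 2, a ∈ {0,1,…,n−1}, and let π = (π_1,…,π_{n−1}) be a permutation of {1,…,n−1}. Set Δ = (a − Σ_{i=1}^{n−2} i·α(π)_i) mod n (so Δ ∈ {0,…,n−1}) and ω = Σ_{i=1}^{n−2} α(π)_i. Suppose ω < Δ < n−1, and let j be the position of the (Δ−ω)-th zero in α(π), i.e., the unique index with α(π)_j = 0 and #{i ≤ j : α(π)_i = 0} = Δ−ω (such j exists since α(π) has n−2−ω zeros and Δ−ω ≤ n−2−ω). Then the permutation σ = (π_1,…,π_j, n, π_{j+1},…,π_{n−1}) satisfies Σ_{i=1}^{n−1} i·α(σ)_i ≡ a (mod n). -/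
namespace Stmt

theorem aux_sum (al f : ℕ → ℕ) (k : ℕ) (h0 : al (k+1) = 0) (d : ℕ)
    (h1 : ∀ i, 1 ≤ i → i ≤ k → f i = al i) (h2 : f (k+1) = 1) (h3 : f (k+2) = 0)
    (h4 : ∀ i, k + 2 ≤ i → i ≤ k + 1 + d → f (i+1) = al i) :
    (∑ i ∈ Finset.Icc 1 (k+1+d+1), i * f i) + ∑ i ∈ Finset.Icc 1 (k+1), al i
      = (∑ i ∈ Finset.Icc 1 (k+1+d), i * al i) + (k+1) + ∑ i ∈ Finset.Icc 1 (k+1+d), al i := by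
  induction d with
  | zero =>
    have h : ∑ i ∈ Finset.Icc 1 k, i * f i = ∑ i ∈ Finset.Icc 1 k, i * al i := by
      apply Finset.sum_congr rfl
      intro i hi
      rw [Finset.mem_Icc] at hi
      rw [h1 i hi.1 hi.2]
    simp only [Nat.add_zero]
    rw [Finset.sum_Icc_succ_top (by omega), Finset.sum_Icc_succ_top (by omega), h,
      Finset.sum_Icc_succ_top (b := k) (f := fun i => i * al i) (by omega), h0, h2, h3]
    ring
  | succ d ih =>
    have ih' := ih (fun i a b => h4 i a (by omega))
    have e := h4 (k+1+d+1) (by omega) (by omega)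
    rw [← add_assoc (k+1) d 1, Finset.sum_Icc_succ_top (by omega),
      Finset.sum_Icc_succ_top (b := k+1+d) (f := fun i => i * al i) (by omega),
      Finset.sum_Icc_succ_top (b := k+1+d) (f := al) (by omega), e]
    linarith

theorem aux_count (al : ℕ → ℕ) (h : ∀ i, al i = 0 ∨ al i = 1) (j : ℕ) :
    ((Finset.Icc 1 j).filter (fun i => al i = 0)).card + ∑ i ∈ Finset.Icc 1 j, al i = j := by
  rw [Finset.card_filter, ← Finset.sum_add_distrib]
  trans ∑ i ∈ Finset.Icc 1 j, 1
  · apply Finset.sum_congr rfl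
    intro i _
    rcases h i with h | h <;> simp [h]
  · simp

/-- encoder correctness, case ω < Δ < n−1. -/
theorem stmt17 (n : ℕ) (hn : 2 ≤ n) (a : ℕ) (ha : a < n)
    (π : ℕ → ℕ) (hπ : Set.BijOn π (Set.Icc 1 (n-1)) (Set.Icc 1 (n-1)))
    (Δ ω : ℕ)
    (hΔ : (Δ : ℤ) = ((a : ℤ) - ∑ i ∈ Finset.Icc 1 (n-2), (i : ℤ) * (sig π i : ℤ)) % (n : ℤ))
    (hω : ω = ∑ i ∈ Finset.Icc 1 (n-2), sig π i)
    (hcase1 : ω < Δ) (hcase2 : Δ < n - 1)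
    (j : ℕ) (hj1 : 1 ≤ j) (hj2 : j ≤ n - 2)
    (hjzero : sig π j = 0)
    (hjcount : ((Finset.Icc 1 j).filter (fun i => sig π i = 0)).card = Δ - ω) :
    (∑ i ∈ Finset.Icc 1 (n-1), i * sig (insSeq π j n) i) ≡ a [MOD n] := by
  obtain ⟨k, rfl⟩ : ∃ k, j = k + 1 := ⟨j - 1, by omega⟩
  obtain ⟨d, hd⟩ : ∃ d, n - 2 = k + 1 + d := ⟨n - 2 - (k+1), by omega⟩
  have hd1 : n - 1 = k + 1 + d + 1 := by omega
  have hb : ∀ i, 1 ≤ i → i ≤ n - 1 → π i < n := by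
    intro i h1 h2
    have := (hπ.mapsTo (Set.mem_Icc.2 ⟨h1, h2⟩)).2
    omega
  have hbj := hb (k+1) (by omega) (by omega)
  have hbj1 := hb (k+2) (by omega) (by omega)
  have key := aux_sum (sig π) (sig (insSeq π (k+1) n)) k hjzero d
    (by
      intro i h1 h2
      have e1 : insSeq π (k+1) n i = π i := if_pos (by omega)
      have e2 : insSeq π (k+1) n (i+1) = π (i+1) := if_pos (by omega)
      simp only [sig, e1, e2])
    (by
      simp only [sig, insSeq]
      simp
      omega)
    (by
      simp only [sig, insSeq]
      simp
      omega)
    (by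
      intro i h1 h2
      have e : ∀ l, k + 2 ≤ l → insSeq π (k+1) n (l+1) = π l := by
        intro l hl
        simp only [insSeq]
        rw [if_neg (by omega), if_neg (by omega), Nat.add_sub_cancel]
      simp only [sig, e i h1, e (i+1) (by omega)])
  have hc := aux_count (sig π) (fun i => by simp only [sig]; split_ifs <;> simp) (k+1)
  rw [hjcount] at hc
  rw [hd] at hω hΔ
  rw [← hω] at key
  rw [hd1]
  have tot : (∑ i ∈ Finset.Icc 1 (k+1+d+1), i * sig (insSeq π (k+1) n) i)
      = (∑ i ∈ Finset.Icc 1 (k+1+d), i * sig π i) + Δ := by omega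
  rw [tot, ← Int.natCast_modEq_iff]
  push_cast
  rw [hΔ]
  have := (Int.mod_modEq ((a : ℤ) - ∑ i ∈ Finset.Icc 1 (k+1+d), (i : ℤ) * (sig π i : ℤ)) n).add_left
    (∑ i ∈ Finset.Icc 1 (k+1+d), (i : ℤ) * (sig π i : ℤ))
  simpa using this

end Stmt
end
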